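/- arXiv:2302.07447 — 2 statements merged into one kernel-verified Lean document; each statement's English description precedes it below -/
import Mathlib

section
/- Let k ≥ 1 and m ≥ 1 be integers, let A be a k×k integer matrix, and let S ⊆ {1,…,k} be a subset with |S| ≤ m. Suppose that every row of A whose index lies outside S is a standard basis vector of ℤ^k (i.e., has one entry equal to 1 and all other entries 0), and that there is an injective map ρ : S → {1,…,m} such that |A_{ij}| ≤ 2^{ρ(i)−1} for every i ∈ S and every j ∈ {1,…,k}. Then |det A| ≤ 2^{m(m−1)/2} · m^{m/2}. (This is the determinant estimate in case (i) of the proof of Theorem 3, obtained by clearing the unit rows and applying the Hadamard inequality.) -/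
/-- **Hadamard's inequality**: the determinant of a real matrix is bounded by the product of the
Euclidean norms of its rows. -/
theorem Matrix.abs_det_le_prod_sqrt {n : ℕ} (M : Matrix (Fin n) (Fin n) ℝ) :
    |M.det| ≤ ∏ i, Real.sqrt (∑ j, M i j ^ 2) := by
  have : Fact (Module.finrank ℝ (EuclideanSpace ℝ (Fin n)) = n) := ⟨by simp⟩
  let b := EuclideanSpace.basisFun (Fin n) ℝ
  have h := b.toBasis.orientation.abs_volumeForm_apply_le fun i => WithLp.toLp 2 (M i)
  rw [b.toBasis.orientation.volumeForm_robust b rfl, Module.Basis.det_apply] at h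
  have hM : b.toBasis.toMatrix (fun i => WithLp.toLp 2 (M i)) = M.transpose := by
    ext i j
    simp [b, Module.Basis.toMatrix_apply]
  simpa [hM, Matrix.det_transpose, EuclideanSpace.norm_eq] using h

/-- If the rows outside `S` are distinct standard basis vectors, located at the columns `c i`,
then clearing those columns in the rows of `S` changes the determinant at most by a sign. -/
theorem Matrix.abs_det_eq_abs_det_clear {n : Type*} [Fintype n] [DecidableEq n]
    (A : Matrix n n ℤ) (S : Finset n) (c : n → n)
    (hc : ∀ i ∉ S, A i (c i) = 1 ∧ ∀ j, j ≠ c i → A i j = 0)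
    (hinj : Set.InjOn c (Sᶜ : Finset n)) :
    |A.det| =
      |(Matrix.of fun i j => if i ∈ S ∧ j ∈ Sᶜ.image c then 0 else A i j).det| := by
  set B : Matrix n n ℤ := Matrix.of fun i j => if i ∈ S ∧ j ∈ Sᶜ.image c then 0 else A i j with hB
  let N : Matrix n n ℤ := Matrix.of fun i u => if i ∈ S ∧ u ∉ S then A i (c u) else 0
  have hNN : N * N = 0 := by
    ext i j
    rw [Matrix.mul_apply]
    refine Finset.sum_eq_zero fun u _ => ?_
    by_cases hu : u ∈ S <;> simp [N, hu]
  have hunit : IsUnit (1 + N).det := by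
    refine IsUnit.of_mul_eq_one (1 - N).det ?_
    rw [← Matrix.det_mul, show (1 + N) * (1 - N) = 1 - N * N by noncomm_ring, hNN]
    simp
  have hAB : A = (1 + N) * B := by
    ext i j
    rw [add_mul, one_mul, Matrix.add_apply, Matrix.mul_apply]
    by_cases hi : i ∈ S
    · by_cases hj : j ∈ Sᶜ.image c
      · obtain ⟨u, hu, rfl⟩ := Finset.mem_image.1 hj
        have huS := Finset.mem_compl.1 hu
        rw [Finset.sum_eq_single u]
        · simp only [hB, N, Matrix.of_apply]
          simp [hi, huS, hj, (hc u huS).1]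
        · intro v _ hvu
          by_cases hv : v ∈ S
          · simp [N, hv]
          · have : c u ≠ c v := fun h => hvu (hinj (by simpa using hv) (by simpa using hu) h.symm)
            simp [B, hv, (hc v hv).2 _ this]
        · simp
      · rw [Finset.sum_eq_zero]
        · simp only [hB, Matrix.of_apply]
          simp [hj]
        · intro v _
          by_cases hv : v ∈ S
          · simp [N, hv]
          · have : j ≠ c v := fun h =>
              hj (Finset.mem_image.2 ⟨v, Finset.mem_compl.2 hv, h.symm⟩)
            simp [B, hv, (hc v hv).2 _ this]
    · simp [N, B, hi]
  rw [hAB, Matrix.det_mul, abs_mul, Int.isUnit_iff_abs_eq.1 hunit, one_mul]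

/-- A sum of distinct elements of `{0, …, m - 1}` is at most `m (m - 1) / 2`. -/
theorem Finset.sum_sub_one_le_of_injOn {ι : Type*} {m : ℕ} (S : Finset ι) (ρ : ι → ℕ)
    (hrange : ∀ i ∈ S, 1 ≤ ρ i ∧ ρ i ≤ m) (hinj : ∀ i ∈ S, ∀ i' ∈ S, ρ i = ρ i' → i = i') :
    ∑ i ∈ S, (ρ i - 1) ≤ m * (m - 1) / 2 := by
  classical
  rw [← Finset.sum_range_id, ← Finset.sum_image (f := fun x => x) (g := fun i => ρ i - 1)]
  · refine Finset.sum_le_sum_of_subset fun x hx => ?_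
    obtain ⟨i, hi, rfl⟩ := Finset.mem_image.1 hx
    have := hrange i hi
    exact Finset.mem_range.2 (by omega)
  · intro i hi j hj h
    have h₁ := hrange i hi
    have h₂ := hrange j hj
    exact hinj i hi j hj (by dsimp only at h; omega)

/-- The Euclidean norm of a vector supported on at most `m` coordinates, all bounded by `b`. -/
theorem Real.sqrt_sum_sq_le_of_support {ι : Type*} [Fintype ι] {m : ℕ} {b : ℝ} (hb : 0 ≤ b)
    (v : ι → ℝ) (T : Finset ι) (hT : T.card ≤ m) (hv : ∀ j ∉ T, v j = 0) (hvb : ∀ j, |v j| ≤ b) :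
    Real.sqrt (∑ j, v j ^ 2) ≤ b * Real.sqrt m := by
  refine Real.sqrt_le_iff.2 ⟨by positivity, ?_⟩
  rw [mul_pow, Real.sq_sqrt (Nat.cast_nonneg m),
    ← Finset.sum_subset T.subset_univ fun j _ hj => by simp [hv j hj]]
  calc ∑ j ∈ T, v j ^ 2 ≤ ∑ _j ∈ T, b ^ 2 :=
        Finset.sum_le_sum fun j _ => sq_le_sq.2 (by simpa [abs_of_nonneg hb] using hvb j)
    _ = T.card * b ^ 2 := by simp
    _ ≤ m * b ^ 2 := by gcongr
    _ = b ^ 2 * m := mul_comm _ _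


/-- **Determinant estimate, case (i) of the proof of Theorem 3.**
Let `A` be a `k × k` integer matrix and `S` a set of row indices with `|S| ≤ m`.
If every row of `A` with index outside `S` is a standard basis vector, and there is a
map `ρ : S → {1,…,m}`, injective on `S`, with `|A i j| ≤ 2 ^ (ρ i - 1)` for all
`i ∈ S` and all `j`, then `|det A| ≤ 2 ^ (m (m - 1) / 2) · m ^ (m / 2)`. -/
theorem det_bound_case_i (k m : ℕ) (hk : 1 ≤ k) (hm : 1 ≤ m)
    (A : Matrix (Fin k) (Fin k) ℤ)
    (S : Finset (Fin k)) (hS : S.card ≤ m)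
    (hunit : ∀ i ∉ S, ∃ j, A i j = 1 ∧ ∀ j', j' ≠ j → A i j' = 0)
    (ρ : Fin k → ℕ)
    (hρrange : ∀ i ∈ S, 1 ≤ ρ i ∧ ρ i ≤ m)
    (hρinj : ∀ i ∈ S, ∀ i' ∈ S, ρ i = ρ i' → i = i')
    (hbound : ∀ i ∈ S, ∀ j, |A i j| ≤ 2 ^ (ρ i - 1)) :
    |(A.det : ℝ)| ≤ 2 ^ (m * (m - 1) / 2) * Real.sqrt m ^ m := by
  have : Nonempty (Fin k) := ⟨⟨0, hk⟩⟩
  choose! c hc using hunit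
  by_cases hinj : Set.InjOn c (Sᶜ : Finset (Fin k))
  swap
  · simp only [Set.InjOn, not_forall] at hinj
    obtain ⟨i, hi, j, hj, hij, hne⟩ := hinj
    have hi' : i ∉ S := by simpa using hi
    have hj' : j ∉ S := by simpa using hj
    have hdet : A.det = 0 := by
      refine Matrix.det_zero_of_row_eq hne (funext fun l => ?_)
      by_cases hl : l = c i
      · rw [hl, (hc i hi').1, hij, (hc j hj').1]
      · rw [(hc i hi').2 l hl, (hc j hj').2 l (hij ▸ hl)]
    rw [hdet]
    simp only [Int.cast_zero, abs_zero]
    positivity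
  have hdet := A.abs_det_eq_abs_det_clear S c hc hinj
  set B : Matrix (Fin k) (Fin k) ℤ :=
    Matrix.of fun i j => if i ∈ S ∧ j ∈ Sᶜ.image c then 0 else A i j with hB
  have hcard : (Sᶜ.image c)ᶜ.card ≤ m := by
    rw [Finset.card_compl, Finset.card_image_of_injOn hinj, Finset.card_compl]
    have := S.card_le_univ
    omega
  have hrowS : ∀ i ∈ S, Real.sqrt (∑ j, (B i j : ℝ) ^ 2) ≤ 2 ^ (ρ i - 1) * Real.sqrt m := by
    intro i hi
    refine Real.sqrt_sum_sq_le_of_support (by positivity) _ _ hcard (fun j hj => ?_) fun j => ?_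
    · simp only [hB, Matrix.of_apply]
      rw [if_pos ⟨hi, by simpa using hj⟩, Int.cast_zero]
    · have h : |B i j| ≤ 2 ^ (ρ i - 1) := by
        simp only [hB, Matrix.of_apply]
        split_ifs
        · simp
        · exact hbound i hi j
      exact_mod_cast h
  have hrow : ∀ i ∉ S, Real.sqrt (∑ j, (B i j : ℝ) ^ 2) = 1 := by
    intro i hi
    rw [Finset.sum_eq_single (c i) (fun j _ hj => by simp [hB, hi, (hc i hi).2 j hj]) (by simp)]
    simp [hB, hi, (hc i hi).1]
  have hm' : (1 : ℝ) ≤ Real.sqrt m := Real.one_le_sqrt.2 (by exact_mod_cast hm)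
  calc |(A.det : ℝ)| = |(B.map (Int.cast : ℤ → ℝ)).det| := by
        rw [← Int.cast_det, ← Int.cast_abs, ← Int.cast_abs, hdet]
    _ ≤ ∏ i, Real.sqrt (∑ j, (B i j : ℝ) ^ 2) := Matrix.abs_det_le_prod_sqrt _
    _ = ∏ i ∈ S, Real.sqrt (∑ j, (B i j : ℝ) ^ 2) :=
        (Finset.prod_subset S.subset_univ fun i _ hi => hrow i hi).symm
    _ ≤ ∏ i ∈ S, (2 ^ (ρ i - 1) * Real.sqrt m) :=
        Finset.prod_le_prod (fun _ _ => Real.sqrt_nonneg _) hrowS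
    _ = 2 ^ (∑ i ∈ S, (ρ i - 1)) * Real.sqrt m ^ S.card := by
        rw [Finset.prod_mul_distrib, Finset.prod_pow_eq_pow_sum, Finset.prod_const]
    _ ≤ 2 ^ (m * (m - 1) / 2) * Real.sqrt m ^ m := by
        gcongr
        · norm_num
        · exact S.sum_sub_one_le_of_injOn ρ hρrange hρinj
end

section
/- Let k, m, p be integers with 1 ≤ k ≤ m and p ≥ 2, and suppose (1/2)·((2/k)·log₂ p + k − log₂ k + 1) ≤ m. Then (1/2)·√((log₂ e)² + 8·log₂ p) − (1/2)·log₂(log₂ e + √((log₂ e)² + 8·log₂ p)) + 1 ≤ m. (This is the passage, in the proof of Theorem 3, from the case-(ii) bound to the final displayed lower bound via minimization over k.) -/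
open Real

/-- The function `x ↦ (a² - c a) / x + x - c log x` attains its minimum over the positive reals
at `x = a`, provided `0 ≤ c ≤ a`. -/
lemma two_mul_sub_le_div_add_sub_log {a c x : ℝ} (hc : 0 ≤ c) (hca : c ≤ a) (ha : 0 < a)
    (hx : 0 < x) :
    2 * a - c - c * log a ≤ (a ^ 2 - c * a) / x + x - c * log x := by
  have hlog : log x - log a ≤ x / a - 1 := by
    rw [← log_div hx.ne' ha.ne']
    exact log_le_sub_one_of_pos (by positivity)
  have hmul := mul_le_mul_of_nonneg_left hlog hc
  have hgap : (a ^ 2 - c * a) / x + x - (2 * a - c) - c * (x / a - 1)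
      = (a - c) * (x - a) ^ 2 / (a * x) := by
    field_simp
    ring
  have hnonneg : 0 ≤ (a - c) * (x - a) ^ 2 / (a * x) :=
    div_nonneg (mul_nonneg (sub_nonneg.2 hca) (sq_nonneg _)) (by positivity)
  linarith

/-- **From the case-(ii) bound to the final lower bound of Theorem 3.**
Let `k, m, p` be integers with `1 ≤ k ≤ m` and `p ≥ 2`, and suppose
`(1/2) ((2/k) log₂ p + k - log₂ k + 1) ≤ m`. Then
`(1/2) √((log₂ e)² + 8 log₂ p) - (1/2) log₂(log₂ e + √((log₂ e)² + 8 log₂ p)) + 1 ≤ m`. -/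
theorem final_bound_from_case_ii (k m p : ℕ) (hk : 1 ≤ k) (hkm : k ≤ m) (hp : 2 ≤ p)
    (h : (1 / 2 : ℝ) * ((2 / k) * logb 2 p + k - logb 2 k + 1) ≤ m) :
    (1 / 2 : ℝ) * Real.sqrt ((logb 2 (exp 1)) ^ 2 + 8 * logb 2 p)
      - (1 / 2) * logb 2 (logb 2 (exp 1) + Real.sqrt ((logb 2 (exp 1)) ^ 2 + 8 * logb 2 p))
      + 1 ≤ m := by
  have hlogb (x : ℝ) : logb 2 x = logb 2 (exp 1) * log x := by
    simp only [logb, log_exp]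
    ring
  have hc : 0 < logb 2 (exp 1) := logb_pos one_lt_two (one_lt_exp_iff.2 one_pos)
  have hL : 0 ≤ logb 2 (p : ℝ) :=
    logb_nonneg one_lt_two (by exact_mod_cast one_le_two.trans hp)
  have hk0 : (0 : ℝ) < k := by exact_mod_cast hk
  set c := logb 2 (exp 1)
  set L := logb 2 (p : ℝ)
  set s := √(c ^ 2 + 8 * L)
  have hs : s ^ 2 = c ^ 2 + 8 * L := sq_sqrt (by positivity)
  have hcs : c ≤ s := le_sqrt_of_sq_le (by linarith)
  have hmin := two_mul_sub_le_div_add_sub_log (a := (c + s) / 2) hc.le (by linarith)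
    (by linarith) hk0
  have hroot : ((c + s) / 2) ^ 2 - c * ((c + s) / 2) = 2 * L := by linarith
  have hhalf : c * log ((c + s) / 2) = logb 2 (c + s) - 1 := by
    rw [← hlogb, logb_div (by linarith) two_ne_zero, logb_self_eq_one one_lt_two]
  rw [hroot, hhalf, ← hlogb, mul_div_right_comm] at hmin
  linarith
end
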